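/- Let n ≥ 2 be even, and let A be a unital associative algebra over a commutative unital ring R that is 2-torsion free and (n−1)-torsion free, with a nontrivial idempotent e, f = 1 − e, satisfying property (Q). Suppose at least one of: (i-1) eAe = S(eAe) and fAf = S(fAf); (i-2) eAe = S(eAe) and Z(eAe) = eZ(A)e; (i-3) fAf = S(fAf) and Z(fAf) = fZ(A)f; (i-4) Z(eAe) = eZ(A)e, Z(fAf) = fZ(A)f, and in case n ≥ 3 additionally eAe or fAf satisfies condition (*). Suppose also at least one of: (ii-1) eAe or fAf has no nonzero central ideal; (ii-2) there exists m₀ ∈ eAf with Z(A) = {a + b : a ∈ eZ(A)e, b ∈ fZ(A)f, am₀ = m₀b}; (ii-3) there exists t₀ ∈ fAe with Z(A) = {a + b : a ∈ eZ(A)e, b ∈ fZ(A)f, t₀a = bt₀}; (ii-4) eAf·fAe = {0} and fAe·eAf = {0}. Then every Lie n-derivation on A is standard. -/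

import Mathlib

open Finset

/-- Iterated commutator: `pCom x k = p_{k+1}(x 0, ..., x k)`, i.e.
`pCom x 0 = x 0` and `pCom x (k+1) = [pCom x k, x (k+1)]`. -/
def pCom {A : Type*} [Ring A] (x : ℕ → A) : ℕ → A
  | 0 => x 0
  | k + 1 => pCom x k * x (k + 1) - x (k + 1) * pCom x k

/-- `φ` is a Lie `n`-derivation. -/
def IsLieNDeriv {R : Type*} {A : Type*} [CommRing R] [Ring A] [Algebra R A]
    (n : ℕ) (φ : A →ₗ[R] A) : Prop :=
  ∀ x : ℕ → A,
    φ (pCom x (n - 1)) =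
      ∑ i ∈ Finset.range n, pCom (Function.update x i (φ (x i))) (n - 1)

/-- `d` is a derivation. -/
def IsDeriv {R : Type*} {A : Type*} [CommRing R] [Ring A] [Algebra R A]
    (d : A →ₗ[R] A) : Prop :=
  ∀ x y : A, d (x * y) = d x * y + x * d y

/-- `δ` is a Jordan derivation. -/
def IsJordanDeriv {R : Type*} {A : Type*} [CommRing R] [Ring A] [Algebra R A]
    (δ : A →ₗ[R] A) : Prop :=
  ∀ x y : A, δ (x * y + y * x) = δ x * y + y * δ x + x * δ y + δ y * x

/-- `δ` is an antiderivation. -/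
def IsAntiDeriv {R : Type*} {A : Type*} [CommRing R] [Ring A] [Algebra R A]
    (δ : A →ₗ[R] A) : Prop :=
  ∀ x y : A, δ (x * y) = δ y * x + y * δ x

/-- `δ` is a singular Jordan derivation relative to the idempotent `e`
(with `f = 1 - e`): it is a Jordan derivation killing `eAe` and `fAf`,
mapping `eAf` into `fAe` and `fAe` into `eAf`. -/
def IsSingularJordanDeriv {R : Type*} {A : Type*} [CommRing R] [Ring A] [Algebra R A]
    (e : A) (δ : A →ₗ[R] A) : Prop :=
  IsJordanDeriv δ ∧
  (∀ a : A, δ (e * a * e) = 0) ∧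
  (∀ b : A, δ ((1 - e) * b * (1 - e)) = 0) ∧
  (∀ m : A, δ (e * m * (1 - e)) = (1 - e) * δ (e * m * (1 - e)) * e) ∧
  (∀ t : A, δ ((1 - e) * t * e) = e * δ ((1 - e) * t * e) * (1 - e))

/-- `z` is a central element. -/
def IsCent {A : Type*} [Ring A] (z : A) : Prop := ∀ y : A, z * y = y * z

/-- The centre of `A` as a set. -/
def centerSet (A : Type*) [Ring A] : Set A := {z : A | ∀ y : A, z * y = y * z}

/-- `γ` vanishes on all `(n-1)`-th commutators. -/
def VanishesOnNCommutators {R : Type*} {A : Type*} [CommRing R] [Ring A] [Algebra R A]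
    (n : ℕ) (γ : A →ₗ[R] A) : Prop :=
  ∀ x : ℕ → A, γ (pCom x (n - 1)) = 0

/-- A Lie `n`-derivation is standard if it is the sum of a derivation and a
central-valued map vanishing on all `(n-1)`-th commutators. -/
def IsStandardLieNDeriv {R : Type*} {A : Type*} [CommRing R] [Ring A] [Algebra R A]
    (n : ℕ) (φ : A →ₗ[R] A) : Prop :=
  ∃ d γ : A →ₗ[R] A,
    IsDeriv d ∧ (∀ x : A, IsCent (γ x)) ∧ VanishesOnNCommutators n γ ∧ φ = d + γ

/-- Property (Q) for the idempotent `e` (with `f = 1 - e`):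
`exe·eAf = 0 = fAe·exe` implies `exe = 0`, and
`eAf·fxf = 0 = fxf·fAe` implies `fxf = 0`. -/
def PropQ {A : Type*} [Ring A] (e : A) : Prop :=
  (∀ x : A,
    ((∀ y : A, (e * x * e) * (e * y * (1 - e)) = 0) ∧
     (∀ y : A, ((1 - e) * y * e) * (e * x * e) = 0)) → e * x * e = 0) ∧
  (∀ x : A,
    ((∀ y : A, (e * y * (1 - e)) * ((1 - e) * x * (1 - e)) = 0) ∧
     (∀ y : A, ((1 - e) * x * (1 - e)) * ((1 - e) * y * e) = 0)) →
        (1 - e) * x * (1 - e) = 0)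

/-- `A` is `k`-torsion free. -/
def TorsionFreeAt (A : Type*) [Ring A] (k : ℕ) : Prop :=
  ∀ x : A, k • x = 0 → x = 0

/-- The centre of the corner algebra `gAg` (for an idempotent `g`). -/
def cornerCenter {A : Type*} [Ring A] (g : A) : Set A :=
  {z : A | z = g * z * g ∧ ∀ a : A, z * (g * a * g) = (g * a * g) * z}

/-- The corner algebra `gAg` has no nonzero central ideal: every
ideal of `gAg` consisting of elements central in `gAg` is zero. -/
def NoNonzeroCentralIdeal (R : Type*) [CommRing R] (A : Type*) [Ring A] [Algebra R A]
    (g : A) : Prop :=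
  ∀ I : Set A, (0 : A) ∈ I →
    (∀ x ∈ I, x = g * x * g) →
    (∀ x ∈ I, ∀ y ∈ I, x + y ∈ I) →
    (∀ r : R, ∀ x ∈ I, r • x ∈ I) →
    (∀ x ∈ I, ∀ a : A, (g * a * g) * x ∈ I) →
    (∀ x ∈ I, ∀ a : A, x * (g * a * g) ∈ I) →
    (∀ x ∈ I, ∀ a : A, x * (g * a * g) = (g * a * g) * x) →
    ∀ x ∈ I, x = 0

/-- The generating set of `S(gAg)`: all idempotents of `gAg` together with all
commutators of elements of `gAg`. -/
def cornerGenSet {A : Type*} [Ring A] (g : A) : Set A :=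
  {x : A | x = g * x * g ∧ x * x = x} ∪
  {x : A | ∃ a b : A, x = (g * a * g) * (g * b * g) - (g * b * g) * (g * a * g)}

/-- `gAg = S(gAg)`: the corner algebra is generated (as an algebra) by its
idempotents and commutators. -/
def CornerGenerated (R : Type*) [CommRing R] {A : Type*} [Ring A] [Algebra R A]
    (g : A) : Prop :=
  ∀ x : A, g * x * g ∈ NonUnitalAlgebra.adjoin R (cornerGenSet g)

/-- Condition (*) for the corner algebra `gAg`: if `[x, gAg] ⊆ Z(gAg)` then
`x ∈ Z(gAg)`. -/
def CornerCondStar {A : Type*} [Ring A] (g : A) : Prop :=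
  ∀ x : A, x = g * x * g →
    (∀ a : A, x * (g * a * g) - (g * a * g) * x ∈ cornerCenter g) →
    x ∈ cornerCenter g

section IteratedCommutators

variable {R : Type*} {A : Type*} [CommRing R] [Ring A] [Algebra R A]

lemma pCom_congr {x y : ℕ → A} {k : ℕ} (h : ∀ i ≤ k, x i = y i) : pCom x k = pCom y k := by
  induction k with
  | zero => exact h 0 le_rfl
  | succ k ih =>
    simp only [pCom]
    rw [ih fun i hi => h i (by omega), h (k + 1) le_rfl]

lemma pCom_update_of_lt (x : ℕ → A) (u : A) {i k : ℕ} (h : k < i) :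
    pCom (Function.update x i u) k = pCom x k :=
  pCom_congr fun j hj => Function.update_of_ne (by omega) _ _

lemma pCom_eq_zero_of_isCent {x : ℕ → A} {i k : ℕ} (hx : IsCent (x i)) (hi : i ≤ k)
    (hk : 1 ≤ k) : pCom x k = 0 := by
  induction k with
  | zero => omega
  | succ k ih =>
    simp only [pCom]
    rcases Nat.lt_or_ge k i with h | h
    · obtain rfl : i = k + 1 := by omega
      rw [hx, sub_self]
    · rcases Nat.eq_zero_or_pos k with rfl | hk'
      · obtain rfl : i = 0 := by omega
        simp only [pCom]
        rw [hx, sub_self]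
      · rw [ih h hk', zero_mul, mul_zero, sub_self]

lemma pCom_update_sub (x : ℕ → A) (u v : A) {i k : ℕ} (hi : i ≤ k) :
    pCom (Function.update x i (u - v)) k =
      pCom (Function.update x i u) k - pCom (Function.update x i v) k := by
  induction k with
  | zero =>
    obtain rfl : i = 0 := by omega
    simp [pCom]
  | succ k ih =>
    simp only [pCom]
    rcases Nat.lt_or_ge k i with h | h
    · obtain rfl : i = k + 1 := by omega
      simp only [pCom_update_of_lt _ _ h, Function.update_self]
      noncomm_ring
    · rw [ih h]
      simp only [Function.update_of_ne (show k + 1 ≠ i by omega)]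
      noncomm_ring

lemma IsLieNDeriv.sub {n : ℕ} {φ ψ : A →ₗ[R] A} (hφ : IsLieNDeriv n φ)
    (hψ : IsLieNDeriv n ψ) : IsLieNDeriv n (φ - ψ) := by
  intro x
  rw [LinearMap.sub_apply, hφ x, hψ x, ← Finset.sum_sub_distrib]
  refine Finset.sum_congr rfl fun i hi => ?_
  rw [LinearMap.sub_apply, pCom_update_sub]
  have := Finset.mem_range.1 hi
  omega

lemma IsDeriv.isLieNDeriv {d : A →ₗ[R] A} (hd : IsDeriv d) {n : ℕ} (hn : 1 ≤ n) :
    IsLieNDeriv n d := by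
  intro x
  obtain ⟨k, rfl⟩ : ∃ k, n = k + 1 := ⟨n - 1, by omega⟩
  simp only [Nat.add_sub_cancel]
  induction k with
  | zero => simp [pCom]
  | succ k ih =>
    rw [Finset.sum_range_succ]
    have h : ∀ i ∈ Finset.range (k + 1), pCom (Function.update x i (d (x i))) (k + 1) =
        pCom (Function.update x i (d (x i))) k * x (k + 1) -
          x (k + 1) * pCom (Function.update x i (d (x i))) k := by
      intro i hi
      have := Finset.mem_range.1 hi
      simp only [pCom, Function.update_of_ne (show k + 1 ≠ i by omega)]
    rw [Finset.sum_congr rfl h, Finset.sum_sub_distrib, ← Finset.sum_mul, ← Finset.mul_sum,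
      ← ih (by omega)]
    simp only [pCom, map_sub, hd _ _, pCom_update_of_lt _ _ (Nat.lt_succ_self k),
      Function.update_self]
    abel

lemma IsDeriv.add {d d' : A →ₗ[R] A} (hd : IsDeriv d) (hd' : IsDeriv d') :
    IsDeriv (d + d') := by
  intro x y
  simp only [LinearMap.add_apply, hd x y, hd' x y]
  noncomm_ring

/-- Right commutation with `e`. -/
def adR (e x : A) : A := x * e - e * x

lemma adR_zsmul (e x : A) (c : ℤ) : adR e (c • x) = c • adR e x := by
  simp only [adR, smul_mul_assoc, mul_smul_comm, smul_sub]

lemma adR_adR_adR {e : A} (he : e * e = e) (x : A) : adR e (adR e (adR e x)) = adR e x := by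
  have h1 : x * e * e = x * e := by rw [mul_assoc, he]
  have h2 : e * (e * x) = e * x := by rw [← mul_assoc, he]
  have h4 : e * (e * (x * e)) = e * (x * e) := by rw [← mul_assoc, he]
  simp only [adR, sub_mul, mul_sub, h1, h2, mul_assoc, h4]
  abel

lemma adR_iterate_odd {e : A} (he : e * e = e) (k : ℕ) (x : A) :
    (adR e)^[2 * k + 1] x = adR e x := by
  induction k with
  | zero => rfl
  | succ k ih =>
    rw [show 2 * (k + 1) + 1 = (2 * k + 1) + 1 + 1 by ring, Function.iterate_succ_apply',
      Function.iterate_succ_apply', ih, adR_adR_adR he]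

lemma adR_iterate_even {e x : A} (hx : adR e (adR e x) = x) (k : ℕ) :
    (adR e)^[2 * k] x = x := by
  induction k with
  | zero => rfl
  | succ k ih =>
    rw [show 2 * (k + 1) = 2 * k + 1 + 1 by ring, Function.iterate_succ_apply',
      Function.iterate_succ_apply', ih, hx]

lemma pCom_const_tail {e : A} {x : ℕ → A} {s : ℕ} (h : ∀ j, s < j → x j = e) (k : ℕ) :
    pCom x (s + k) = (adR e)^[k] (pCom x s) := by
  induction k with
  | zero => rfl
  | succ k ih =>
    rw [Function.iterate_succ_apply', ← ih, ← add_assoc]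
    simp only [pCom, adR, h (s + k + 1) (by omega)]

/-- The sequence `x, y, z, e, e, ...`. -/
def tailSeq (e x y z : A) : ℕ → A
  | 0 => x
  | 1 => y
  | 2 => z
  | _ => e

lemma IsLieNDeriv.tail_three {φ : A →ₗ[R] A} {k : ℕ} (hφ : IsLieNDeriv (k + 3) φ) {e : A}
    (he : IsCent (φ e)) (x y z : A) :
    φ ((adR e)^[k] ((x * y - y * x) * z - z * (x * y - y * x))) =
      (adR e)^[k] ((φ x * y - y * φ x) * z - z * (φ x * y - y * φ x)) +
      (adR e)^[k] ((x * φ y - φ y * x) * z - z * (x * φ y - φ y * x)) +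
      (adR e)^[k] ((x * y - y * x) * φ z - φ z * (x * y - y * x)) := by
  have key : ∀ x y z : A, pCom (tailSeq e x y z) (k + 2) =
      (adR e)^[k] ((x * y - y * x) * z - z * (x * y - y * x)) := by
    intro x y z
    rw [add_comm, pCom_const_tail (e := e)]
    · rfl
    · intro j hj
      obtain ⟨i, rfl⟩ : ∃ i, j = i + 3 := ⟨j - 3, by omega⟩
      rfl
  have h := hφ (tailSeq e x y z)
  rw [Finset.sum_range_succ', Finset.sum_range_succ', Finset.sum_range_succ',
    Finset.sum_eq_zero] at h
  · have h0 : Function.update (tailSeq e x y z) 0 (φ x) = tailSeq e (φ x) y z := by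
      funext j; rcases j with _ | _ | _ | j <;> simp [tailSeq]
    have h1 : Function.update (tailSeq e x y z) 1 (φ y) = tailSeq e x (φ y) z := by
      funext j; rcases j with _ | _ | _ | j <;> simp [tailSeq]
    have h2 : Function.update (tailSeq e x y z) 2 (φ z) = tailSeq e x y (φ z) := by
      funext j; rcases j with _ | _ | _ | j <;> simp [tailSeq]
    simp only [tailSeq, zero_add, show k + 3 - 1 = k + 2 by omega,
      Nat.reduceAdd] at h
    change φ (pCom (tailSeq e x y z) (k + 2)) =
      pCom (Function.update (tailSeq e x y z) 2 (φ z)) (k + 2) +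
      pCom (Function.update (tailSeq e x y z) 1 (φ y)) (k + 2) +
      pCom (Function.update (tailSeq e x y z) 0 (φ x)) (k + 2) at h
    rw [h0, h1, h2, key, key, key, key] at h
    rw [h]; abel
  · intro i hi
    have := Finset.mem_range.1 hi
    refine pCom_eq_zero_of_isCent (i := i + 1 + 1 + 1) ?_ (by omega) (by omega)
    rw [Function.update_self]
    exact he

lemma IsLieNDeriv.tail_two {φ : A →ₗ[R] A} {k : ℕ} (hφ : IsLieNDeriv (k + 2) φ) {e : A}
    (he : IsCent (φ e)) (x y : A) :
    φ ((adR e)^[k] (x * y - y * x)) =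
      (adR e)^[k] (φ x * y - y * φ x) + (adR e)^[k] (x * φ y - φ y * x) := by
  have key : ∀ x y : A, pCom (tailSeq e x y e) (k + 1) = (adR e)^[k] (x * y - y * x) := by
    intro x y
    rw [add_comm, pCom_const_tail (e := e)]
    · rfl
    · intro j hj
      obtain ⟨i, rfl⟩ : ∃ i, j = i + 2 := ⟨j - 2, by omega⟩
      rcases i with _ | i <;> rfl
  have h := hφ (tailSeq e x y e)
  rw [Finset.sum_range_succ', Finset.sum_range_succ', Finset.sum_eq_zero] at h
  · have h0 : Function.update (tailSeq e x y e) 0 (φ x) = tailSeq e (φ x) y e := by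
      funext j; rcases j with _ | _ | _ | j <;> simp [tailSeq]
    have h1 : Function.update (tailSeq e x y e) 1 (φ y) = tailSeq e x (φ y) e := by
      funext j; rcases j with _ | _ | _ | j <;> simp [tailSeq]
    rw [zero_add] at h
    change φ (pCom (tailSeq e x y e) (k + 1)) =
      pCom (Function.update (tailSeq e x y e) 1 (φ y)) (k + 1) +
      pCom (Function.update (tailSeq e x y e) 0 (φ x)) (k + 1) at h
    rw [h0, h1, key, key, key] at h
    rw [h]; abel
  · intro i hi
    have := Finset.mem_range.1 hi
    have h2 : tailSeq e x y e (i + 1 + 1) = e := by rcases i with _ | i <;> rfl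
    refine pCom_eq_zero_of_isCent (i := i + 1 + 1) ?_ (by omega) (by omega)
    rw [Function.update_self, h2]
    exact he

lemma IsLieNDeriv.tail_one {φ : A →ₗ[R] A} {k : ℕ} (hφ : IsLieNDeriv (k + 2) φ) {e : A}
    (he : IsCent (φ e)) (x : A) :
    φ ((adR e)^[k + 1] x) = (adR e)^[k + 1] (φ x) := by
  have h := hφ.tail_two he x e
  simp only [Function.iterate_succ_apply]
  have h0 : x * φ e - φ e * x = 0 := by rw [he, sub_self]
  have h1 : (adR e)^[k] (0 : A) = 0 :=
    Function.iterate_fixed (by simp [adR]) k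
  rw [h0, h1, add_zero] at h
  exact h

/-- If `φ e` commutes with `e` and `y` is an eigenvector of `adR e`, then every term of the
expansion of `φ (p_n(y, e, ..., e))` beyond the first is the same multiple of `[y, φ e]`. -/
lemma pCom_update_eigen {e c y : A} {ε : ℤ} (hc : e * c = c * e)
    (hy : adR e y = ε • y) (i k : ℕ) (hi : i ≤ k) :
    pCom (Function.update (tailSeq e y e e) (i + 1) c) (k + 1) =
      ε ^ k • (y * c - c * y) := by
  have ht : ∀ j, tailSeq e y e e (j + 1) = e := by
    intro j; rcases j with _ | _ | j <;> rfl
  have hit : ∀ k, pCom (tailSeq e y e e) k = ε ^ k • y := by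
    intro k
    induction k with
    | zero => simp [pCom, tailSeq]
    | succ k ih =>
      simp only [pCom, ih, ht]
      rw [pow_succ, mul_smul, ← hy, adR]
      simp only [smul_mul_assoc, mul_smul_comm, smul_sub]
  have hL : adR e (y * c - c * y) = ε • (y * c - c * y) := by
    have : adR e (y * c - c * y) = adR e y * c - c * adR e y := by
      have h1 : y * c * e = y * e * c := by rw [mul_assoc, ← hc, mul_assoc]
      have h2 : e * (c * y) = c * (e * y) := by rw [← mul_assoc, hc, mul_assoc]
      simp only [adR, sub_mul, mul_sub, h1, h2, mul_assoc]
      abel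
    rw [this, hy, smul_mul_assoc, mul_smul_comm, smul_sub]
  induction k with
  | zero =>
    obtain rfl : i = 0 := by omega
    simp [pCom, tailSeq]
  | succ k ih =>
    rw [pCom]
    rcases Nat.lt_or_ge k i with h | h
    · obtain rfl : i = k + 1 := by omega
      rw [pCom_update_of_lt _ _ (Nat.lt_succ_self _), Function.update_self, hit]
      simp only [smul_mul_assoc, mul_smul_comm, smul_sub]
    · rw [ih h, Function.update_of_ne (by omega), ht, pow_succ, mul_smul, ← hL, ← adR_zsmul]
      rfl

lemma IsLieNDeriv.eigen {φ : A →ₗ[R] A} {k : ℕ} (hφ : IsLieNDeriv (k + 2) φ) {e y : A}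
    {ε : ℤ} (hc : e * φ e = φ e * e) (hy : adR e y = ε • y) :
    ε ^ (k + 1) • φ y =
      (adR e)^[k + 1] (φ y) + (k + 1) • ε ^ k • (y * φ e - φ e * y) := by
  have ht : ∀ j, tailSeq e y e e (j + 1) = e := by
    intro j; rcases j with _ | _ | j <;> rfl
  have hit : ∀ z, pCom (tailSeq e z e e) (k + 1) = (adR e)^[k + 1] z := by
    intro z
    rw [← zero_add (k + 1), pCom_const_tail (e := e)]
    · simp [pCom, tailSeq]
    · intro j hj
      obtain ⟨i, rfl⟩ : ∃ i, j = i + 1 := ⟨j - 1, by omega⟩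
      rcases i with _ | _ | i <;> rfl
  have hpow : ∀ k, (adR e)^[k] y = ε ^ k • y := by
    intro k
    induction k with
    | zero => simp
    | succ k ih =>
      rw [Function.iterate_succ_apply', ih, pow_succ, mul_smul, ← hy, adR_zsmul]
  have h := hφ (tailSeq e y e e)
  rw [Finset.sum_range_succ'] at h
  have h0 : Function.update (tailSeq e y e e) 0 (φ y) = tailSeq e (φ y) e e := by
    funext j; rcases j with _ | _ | _ | j <;> simp [tailSeq]
  have hs : ∀ i ∈ Finset.range (k + 1),
      pCom (Function.update (tailSeq e y e e) (i + 1) (φ (tailSeq e y e e (i + 1))))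
        (k + 2 - 1) = ε ^ k • (y * φ e - φ e * y) := by
    intro i hi
    have := Finset.mem_range.1 hi
    rw [ht]
    exact pCom_update_eigen hc hy i k (by omega)
  rw [Finset.sum_congr rfl hs, Finset.sum_const, Finset.card_range] at h
  change φ (pCom (tailSeq e y e e) (k + 1)) = _ +
    pCom (Function.update (tailSeq e y e e) 0 (φ y)) (k + 1) at h
  rw [h0, hit, hit, hpow, map_zsmul] at h
  rw [h, add_comm]

end IteratedCommutators

section PeirceDecomposition

/-- `x ∈ gAh` for idempotents `g`, `h`. -/
def Blk {A : Type*} [Ring A] (g h x : A) : Prop := g * x = x ∧ x * h = x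

variable {R : Type*} {A : Type*} [CommRing R] [Ring A] [Algebra R A]

lemma Blk.mul {g h k l x y : A} (hx : Blk g h x) (hy : Blk k l y) : Blk g l (x * y) :=
  ⟨by rw [← mul_assoc, hx.1], by rw [mul_assoc, hy.2]⟩

lemma Blk.add {g h x y : A} (hx : Blk g h x) (hy : Blk g h y) : Blk g h (x + y) :=
  ⟨by rw [mul_add, hx.1, hy.1], by rw [add_mul, hx.2, hy.2]⟩

lemma Blk.sub {g h x y : A} (hx : Blk g h x) (hy : Blk g h y) : Blk g h (x - y) :=
  ⟨by rw [mul_sub, hx.1, hy.1], by rw [sub_mul, hx.2, hy.2]⟩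

lemma Blk.neg {g h x : A} (hx : Blk g h x) : Blk g h (-x) :=
  ⟨by rw [mul_neg, hx.1], by rw [neg_mul, hx.2]⟩

lemma Blk.smul {g h x : A} (hx : Blk g h x) (r : R) : Blk g h (r • x) :=
  ⟨by rw [mul_smul_comm, hx.1], by rw [smul_mul_assoc, hx.2]⟩

lemma Blk.zero (g h : A) : Blk g h 0 := ⟨mul_zero _, zero_mul _⟩

lemma Blk.mul_eq_zero {g h k l x y : A} (hx : Blk g h x) (hy : Blk k l y) (h0 : h * k = 0) :
    x * y = 0 := by
  rw [← hx.2, ← hy.1, mul_assoc, ← mul_assoc h, h0, zero_mul, mul_zero]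

lemma IsCent.add {x y : A} (hx : IsCent x) (hy : IsCent y) : IsCent (x + y) := fun u => by
  rw [add_mul, mul_add, hx, hy]

lemma IsCent.sub {x y : A} (hx : IsCent x) (hy : IsCent y) : IsCent (x - y) := fun u => by
  rw [sub_mul, mul_sub, hx, hy]

lemma IsCent.neg {x : A} (hx : IsCent x) : IsCent (-x) := fun u => by
  rw [neg_mul, mul_neg, hx]

lemma IsCent.smul {x : A} (hx : IsCent x) (r : R) : IsCent (r • x) := fun u => by
  rw [smul_mul_assoc, mul_smul_comm, hx]

lemma IsCent.zero : IsCent (0 : A) := fun u => by rw [zero_mul, mul_zero]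

/-- `e`, `f` are complementary idempotents with property (Q). -/
structure PeirceQ (e f : A) : Prop where
  ee : e * e = e
  ff : f * f = f
  ef : e * f = 0
  fe : f * e = 0
  one : e + f = 1
  qe : ∀ x, Blk e e x → (∀ m, Blk e f m → x * m = 0) → (∀ t, Blk f e t → t * x = 0) → x = 0
  qf : ∀ x, Blk f f x → (∀ t, Blk f e t → x * t = 0) → (∀ m, Blk e f m → m * x = 0) → x = 0

namespace PeirceQ

variable {e f : A}

lemma symm (h : PeirceQ e f) : PeirceQ f e where
  ee := h.ff
  ff := h.ee
  ef := h.fe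
  fe := h.ef
  one := by rw [add_comm, h.one]
  qe := h.qf
  qf := h.qe

lemma blk_ee (h : PeirceQ e f) (x : A) : Blk e e (e * x * e) :=
  ⟨by rw [← mul_assoc, ← mul_assoc, h.ee], by rw [mul_assoc, h.ee]⟩

lemma blk_ef (h : PeirceQ e f) (x : A) : Blk e f (e * x * f) :=
  ⟨by rw [← mul_assoc, ← mul_assoc, h.ee], by rw [mul_assoc, h.ff]⟩

lemma blk_mul (h : PeirceQ e f) {x : A} (hx : e * x = x * e) : Blk e e (e * x) :=
  ⟨by rw [← mul_assoc, h.ee], by rw [mul_assoc, ← hx, ← mul_assoc, h.ee]⟩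

lemma decomp (h : PeirceQ e f) (x : A) :
    x = e * x * e + e * x * f + f * x * e + f * x * f := by
  have : (e + f) * x * (e + f) = x := by rw [h.one, one_mul, mul_one]
  rw [← this]
  simp only [add_mul, mul_add, mul_assoc, h.ee, h.ff, h.ef, h.fe, mul_zero, add_zero,
    zero_add]
  simp only [← mul_assoc, h.ee, h.ff, h.ef, h.fe, zero_mul, add_zero, zero_add]
  abel

lemma induction (h : PeirceQ e f) {p : A → Prop} (ha : ∀ x y, p x → p y → p (x + y))
    (h1 : ∀ x, Blk e e x → p x) (h2 : ∀ x, Blk e f x → p x) (h3 : ∀ x, Blk f e x → p x)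
    (h4 : ∀ x, Blk f f x → p x) (x : A) : p x := by
  rw [h.decomp x]
  exact ha _ _ (ha _ _ (ha _ _ (h1 _ (h.blk_ee x)) (h2 _ (h.blk_ef x)))
    (h3 _ (h.symm.blk_ef x))) (h4 _ (h.symm.blk_ee x))

lemma comm_f (h : PeirceQ e f) {x : A} (hx : e * x = x * e) : f * x = x * f := by
  rw [show f = 1 - e from eq_sub_of_add_eq' h.one, sub_mul, mul_sub, hx, one_mul, mul_one]

lemma diag_decomp (h : PeirceQ e f) (x : A) : x = e * x + f * x := by
  rw [← add_mul, h.one, one_mul]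

lemma comm_of_ee (_ : PeirceQ e f) {x : A} (hx : Blk e e x) : e * x = x * e := by
  rw [hx.1, hx.2]

lemma comm_of_ff (h : PeirceQ e f) {x : A} (hx : Blk f f x) : e * x = x * e :=
  h.symm.comm_f (h.symm.comm_of_ee hx)

lemma isCent_of_comm (h : PeirceQ e f) {x : A} (hx : e * x = x * e)
    (hm : ∀ m, Blk e f m → x * m = m * x) (ht : ∀ t, Blk f e t → x * t = t * x) :
    IsCent x := by
  have hf := h.comm_f hx
  refine h.induction ?_ ?_ (fun m => hm m) (fun t => ht t) ?_
  · intro u v hu hv; rw [mul_add, add_mul, hu, hv]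
  · intro a ha
    have hb : Blk e e (x * a - a * x) :=
      ⟨by rw [mul_sub, ← mul_assoc, hx, mul_assoc, ha.1, ← mul_assoc, ha.1],
        by rw [sub_mul, mul_assoc, ha.2, mul_assoc, ← hx, ← mul_assoc, ha.2]⟩
    refine sub_eq_zero.1 (h.qe _ hb (fun m hm' => ?_) fun t ht' => ?_)
    · rw [sub_mul, mul_assoc, hm _ (ha.mul hm'), mul_assoc, mul_assoc, hm _ hm', sub_self]
    · rw [mul_sub, ← mul_assoc, ← ht _ ht', ← mul_assoc, ← ht _ (ht'.mul ha), mul_assoc,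
        sub_self]
  · intro a ha
    have hb : Blk f f (x * a - a * x) :=
      ⟨by rw [mul_sub, ← mul_assoc, hf, mul_assoc, ha.1, ← mul_assoc, ha.1],
        by rw [sub_mul, mul_assoc, ha.2, mul_assoc, ← hf, ← mul_assoc, ha.2]⟩
    refine sub_eq_zero.1 (h.qf _ hb (fun t ht' => ?_) fun m hm' => ?_)
    · rw [sub_mul, mul_assoc, ht _ (ha.mul ht'), mul_assoc, mul_assoc, ht _ ht', sub_self]
    · rw [mul_sub, ← mul_assoc, ← hm _ hm', ← mul_assoc, ← hm _ (hm'.mul ha), mul_assoc,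
        sub_self]

/-- A central element in `eAe` vanishes. -/
lemma eq_zero_of_isCent (h : PeirceQ e f) {x : A} (hc : IsCent x) (hx : f * x = 0) : x = 0 := by
  have h1 : e * x = x := by
    conv_rhs => rw [h.diag_decomp x, hx, add_zero]
  refine h.qe x ⟨h1, by rw [hc, h1]⟩ (fun m hm => ?_) fun t ht => ?_
  · rw [hc, ← hm.2, mul_assoc, hx, mul_zero]
  · rw [← hc, ← ht.1, ← mul_assoc, hc, hx, zero_mul]

end PeirceQ

/-- What a Lie `n`-derivation `φ` (`n` even) with `φ e` central looks like with respect to the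
Peirce decomposition. -/
structure LieSplit (e f : A) (φ : A →ₗ[R] A) : Prop where
  q : PeirceQ e f
  map_ef : ∀ m, Blk e f m → Blk e f (φ m)
  map_fe : ∀ t, Blk f e t → Blk f e (φ t)
  map_diag : ∀ x, e * x = x * e → e * φ x = φ x * e
  lie_ef : ∀ x m, e * x = x * e → Blk e f m →
    φ (x * m - m * x) = φ x * m - m * φ x + (x * φ m - φ m * x)
  lie_fe : ∀ x t, e * x = x * e → Blk f e t →
    φ (x * t - t * x) = φ x * t - t * φ x + (x * φ t - φ t * x)
  cent_diag : ∀ a b, Blk e e a → Blk f f b → IsCent (φ a * b - b * φ a + (a * φ b - φ b * a))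
  cent_off : ∀ m t, Blk e f m → Blk f e t →
    IsCent (φ (m * t - t * m) - (φ m * t - t * φ m + (m * φ t - φ t * m)))

namespace LieSplit

variable {e f : A} {φ : A →ₗ[R] A}

lemma symm (h : LieSplit e f φ) : LieSplit f e φ where
  q := h.q.symm
  map_ef := h.map_fe
  map_fe := h.map_ef
  map_diag x hx := h.q.comm_f (h.map_diag x (h.q.symm.comm_f hx))
  lie_ef x t hx := h.lie_fe x t (h.q.symm.comm_f hx)
  lie_fe x t hx := h.lie_ef x t (h.q.symm.comm_f hx)
  cent_diag a b ha hb := by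
    have := (h.cent_diag b a hb ha).neg
    convert this using 1
    abel
  cent_off m t hm ht := by
    have := (h.cent_off t m ht hm).neg
    convert this using 1
    rw [show m * t - t * m = -(t * m - m * t) by abel, map_neg]
    abel

lemma map_mul_ef (h : LieSplit e f φ) {a m : A} (ha : Blk e e a) (hm : Blk e f m) :
    φ (a * m) = φ a * m - m * φ a + a * φ m := by
  have h1 := h.lie_ef a m (h.q.comm_of_ee ha) hm
  rwa [hm.mul_eq_zero ha h.q.fe, (h.map_ef m hm).mul_eq_zero ha h.q.fe, sub_zero, sub_zero] at h1

lemma map_mul_fe (h : LieSplit e f φ) {a t : A} (ha : Blk e e a) (ht : Blk f e t) :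
    φ (t * a) = t * φ a - φ a * t + φ t * a := by
  have h1 := h.lie_fe a t (h.q.comm_of_ee ha) ht
  rw [ha.mul_eq_zero ht h.q.ef, ha.mul_eq_zero (h.map_fe t ht) h.q.ef, zero_sub, zero_sub,
    map_neg] at h1
  rw [← neg_inj, h1]
  abel

/-- The `f`-component of `φ a` is the `f`-component of a central element as soon as it acts on
`eAf` and `fAe` as an element of `eAe`. -/
lemma exists_cent (h : LieSplit e f φ) {a c : A} (ha : Blk e e a) (hc : e * c = c * e)
    (hm : ∀ m, Blk e f m → c * m = m * φ a) (ht : ∀ t, Blk f e t → t * c = φ a * t) :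
    ∃ z, IsCent z ∧ f * z = f * φ a := by
  have hd := h.map_diag a (h.q.comm_of_ee ha)
  have hb : Blk f f (f * φ a) := h.q.symm.blk_mul (h.q.comm_f hd)
  have hec : Blk e e (e * c) := h.q.blk_mul hc
  refine ⟨e * c + f * φ a, h.q.isCent_of_comm ?_ (fun m hm' => ?_) (fun t ht' => ?_), ?_⟩
  · rw [mul_add, add_mul, h.q.comm_of_ee hec, h.q.comm_of_ff hb]
  · rw [add_mul, mul_add, hb.mul_eq_zero hm' h.q.fe, hm'.mul_eq_zero hec h.q.fe, hc, mul_assoc,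
      hm'.1, hm m hm', ← mul_assoc, hm'.2, add_zero, zero_add]
  · rw [add_mul, mul_add, hec.mul_eq_zero ht' h.q.ef, ht'.mul_eq_zero hb h.q.ef, ← mul_assoc t,
      ht'.2, ht t ht', h.q.comm_f hd, mul_assoc, ht'.1, add_zero, zero_add]
  · rw [mul_add, hb.1, ← mul_assoc, h.q.fe, zero_mul, zero_add]

lemma map_mul_mul_ef (h : LieSplit e f φ) {a b m : A} (ha : Blk e e a) (hb : Blk e e b)
    (hm : Blk e f m) :
    φ (a * b) * m - m * φ (a * b) =
      φ a * (b * m) - b * m * φ a + a * (φ b * m - m * φ b) := by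
  have h1 := h.map_mul_ef (ha.mul hb) hm
  rw [mul_assoc a b m, h.map_mul_ef ha (hb.mul hm), h.map_mul_ef hb hm, mul_assoc a b] at h1
  rw [mul_add, ← add_assoc] at h1
  exact (add_right_cancel h1).symm

lemma map_mul_mul_fe (h : LieSplit e f φ) {a b t : A} (ha : Blk e e a) (hb : Blk e e b)
    (ht : Blk f e t) :
    t * φ (a * b) - φ (a * b) * t =
      t * a * φ b - φ b * (t * a) + (t * φ a - φ a * t) * b := by
  have h1 := h.map_mul_fe (ha.mul hb) ht
  rw [← mul_assoc t a b, h.map_mul_fe hb (ht.mul ha), h.map_mul_fe ha ht, ← mul_assoc (φ t)] at h1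
  rw [add_mul, ← add_assoc] at h1
  exact (add_right_cancel h1).symm

lemma exists_cent_mul (h : LieSplit e f φ) {a b : A} (ha : Blk e e a) (hb : Blk e e b)
    (hza : ∃ z, IsCent z ∧ f * z = f * φ a) (hzb : ∃ z, IsCent z ∧ f * z = f * φ b) :
    ∃ z, IsCent z ∧ f * z = f * φ (a * b) := by
  obtain ⟨z, hz, hza⟩ := hza
  obtain ⟨w, hw, hwb⟩ := hzb
  have da := h.map_diag a (h.q.comm_of_ee ha)
  have db := h.map_diag b (h.q.comm_of_ee hb)
  have dab := h.map_diag _ (h.q.comm_of_ee (ha.mul hb))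
  have hD : e * (φ (a * b) - φ a * b - a * φ b + b * z + a * w) =
      (φ (a * b) - φ a * b - a * φ b + b * z + a * w) * e := by
    have h1 : e * (φ a * b) = φ a * b * e := by
      rw [← mul_assoc, da, mul_assoc, hb.1, mul_assoc, hb.2]
    have h2 : e * (a * φ b) = a * φ b * e := by
      rw [← mul_assoc, ha.1, mul_assoc, ← db, ← mul_assoc, ha.2]
    have h3 : e * (b * z) = b * z * e := by
      rw [← mul_assoc, hb.1, mul_assoc, hz, ← mul_assoc, hb.2]
    have h4 : e * (a * w) = a * w * e := by
      rw [← mul_assoc, ha.1, mul_assoc, hw, ← mul_assoc, ha.2]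
    simp only [mul_add, mul_sub, add_mul, sub_mul, h1, h2, h3, h4, dab]
  refine h.exists_cent (ha.mul hb) hD (fun m hm => ?_) fun t ht => ?_
  · have e1 : ∀ m', Blk e f m' → m' * φ a = z * m' := fun m' hm' => by
      rw [← hm'.2, mul_assoc, ← hza, ← mul_assoc, hm'.2, hz]
    have e2 : m * φ b = w * m := by
      rw [← hm.2, mul_assoc, ← hwb, ← mul_assoc, hm.2, hw]
    have key := h.map_mul_mul_ef ha hb hm
    rw [e1 _ (hb.mul hm), e2] at key
    linear_combination (norm := noncomm_ring) key - hz b * m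
  · have e1 : φ a * t = z * t := by
      rw [← ht.1, ← mul_assoc, ← h.q.comm_f da, ← hza, ← hz f, mul_assoc, ht.1]
    have e2 : ∀ t', Blk f e t' → φ b * t' = w * t' := fun t' ht' => by
      rw [← ht'.1, ← mul_assoc, ← h.q.comm_f db, ← hwb, ← hw f, mul_assoc, ht'.1]
    have key := h.map_mul_mul_fe ha hb ht
    rw [e1, e2 _ (ht.mul ha)] at key
    linear_combination (norm := noncomm_ring) key - hz (t * b) - hw (t * a)

lemma exists_cent_commutator (h : LieSplit e f φ) {a b : A} (ha : Blk e e a) (hb : Blk e e b) :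
    ∃ z, IsCent z ∧ f * z = f * φ (a * b - b * a) := by
  have da := h.map_diag a (h.q.comm_of_ee ha)
  have db := h.map_diag b (h.q.comm_of_ee hb)
  have hab : Blk e e (a * b - b * a) := (ha.mul hb).sub (hb.mul ha)
  have dab := h.map_diag _ (h.q.comm_of_ee hab)
  have hD : e * (φ (a * b - b * a) - (φ a * b - b * φ a) - (a * φ b - φ b * a)) =
      (φ (a * b - b * a) - (φ a * b - b * φ a) - (a * φ b - φ b * a)) * e := by
    have h1 : e * (φ a * b) = φ a * b * e := by
      rw [← mul_assoc, da, mul_assoc, hb.1, mul_assoc, hb.2]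
    have h2 : e * (a * φ b) = a * φ b * e := by
      rw [← mul_assoc, ha.1, mul_assoc, ← db, ← mul_assoc, ha.2]
    have h3 : e * (b * φ a) = b * φ a * e := by
      rw [← mul_assoc, hb.1, mul_assoc, ← da, ← mul_assoc, hb.2]
    have h4 : e * (φ b * a) = φ b * a * e := by
      rw [← mul_assoc, db, mul_assoc, ha.1, mul_assoc, ha.2]
    simp only [mul_sub, sub_mul, h1, h2, h3, h4, dab]
  refine h.exists_cent hab hD (fun m hm => ?_) fun t ht => ?_
  · have k1 := h.map_mul_mul_ef ha hb hm
    have k2 := h.map_mul_mul_ef hb ha hm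
    rw [map_sub]
    linear_combination (norm := noncomm_ring) k1 - k2
  · have k1 := h.map_mul_mul_fe ha hb ht
    have k2 := h.map_mul_mul_fe hb ha ht
    rw [map_sub]
    linear_combination (norm := noncomm_ring) k1 - k2

lemma exists_cent_idempotent (h : LieSplit e f φ) {p : A} (hp : Blk e e p) (hpp : p * p = p) :
    ∃ z, IsCent z ∧ f * z = f * φ p := by
  have dp := h.map_diag p (h.q.comm_of_ee hp)
  have hD : e * (p * φ p * p + (e - p) * φ p * (e - p)) =
      (p * φ p * p + (e - p) * φ p * (e - p)) * e := by
    have h1 : e * (e - p) = e - p := by rw [mul_sub, h.q.ee, hp.1]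
    have h2 : (e - p) * e = e - p := by rw [sub_mul, h.q.ee, hp.2]
    rw [mul_add, add_mul, ← mul_assoc, ← mul_assoc, hp.1, ← mul_assoc, ← mul_assoc, h1,
      mul_assoc _ p e, hp.2, mul_assoc _ (e - p) e, h2]
  refine h.exists_cent hp hD (fun m hm => ?_) fun t ht => ?_
  · have key := h.map_mul_mul_ef hp hp hm
    rw [hpp] at key
    have h1 : p * φ p * p * m = p * m * φ p := by
      have := congrArg (p * ·) key
      simp only [mul_add, mul_sub, ← mul_assoc, hpp] at this
      linear_combination (norm := noncomm_ring) -this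
    have h2 : (e - p) * φ p * (e - p) * m = m * φ p - p * m * φ p := by
      have h3 : (e - p) * p = 0 := by rw [sub_mul, hp.1, hpp, sub_self]
      have := congrArg ((e - p) * ·) key
      simp only [mul_add, mul_sub, ← mul_assoc, h3, zero_mul] at this
      have h4 : φ p * e * m = φ p * m := by rw [mul_assoc, hm.1]
      have h5 : (e - p) * m = m - p * m := by rw [sub_mul, hm.1]
      rw [h5] at this
      linear_combination (norm := noncomm_ring) this + (e - p) * h4
    rw [add_mul, h1, h2]
    abel
  · have key := h.map_mul_mul_fe hp hp ht
    rw [hpp] at key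
    have h1 : t * (p * φ p * p) = φ p * (t * p) := by
      have := congrArg (· * p) key
      simp only [add_mul, sub_mul, mul_assoc, hpp] at this
      linear_combination (norm := noncomm_ring) -this
    have h2 : t * ((e - p) * φ p * (e - p)) = φ p * t - φ p * (t * p) := by
      have h3 : p * (e - p) = 0 := by rw [mul_sub, hp.2, hpp, sub_self]
      have := congrArg (· * (e - p)) key
      simp only [add_mul, sub_mul, mul_assoc, h3, mul_zero] at this
      have h4 : t * (e * φ p) = t * φ p := by rw [← mul_assoc, ht.2]
      have h5 : t * (e - p) = t - t * p := by rw [mul_sub, ht.2]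
      rw [h5] at this
      linear_combination (norm := noncomm_ring) this + h4 * (e - p)
    rw [mul_add, h1, h2]
    abel

lemma exists_cent_of_cornerGenerated (h : LieSplit e f φ) (hS : CornerGenerated R e) {a : A}
    (ha : Blk e e a) : ∃ z, IsCent z ∧ f * z = f * φ a := by
  have hmem := hS a
  rw [ha.1, ha.2] at hmem
  suffices Blk e e a ∧ ∃ z, IsCent z ∧ f * z = f * φ a from this.2
  clear ha
  induction hmem using NonUnitalAlgebra.adjoin_induction with
  | mem x hx =>
    rcases hx with ⟨h1, h2⟩ | ⟨u, v, rfl⟩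
    · have hb : Blk e e x := by rw [h1]; exact h.q.blk_ee x
      exact ⟨hb, h.exists_cent_idempotent hb h2⟩
    · have hu := h.q.blk_ee u
      have hv := h.q.blk_ee v
      exact ⟨(hu.mul hv).sub (hv.mul hu), h.exists_cent_commutator hu hv⟩
  | add x y _ _ hx hy =>
    obtain ⟨hx, z, hz, hxz⟩ := hx
    obtain ⟨hy, w, hw, hyw⟩ := hy
    exact ⟨hx.add hy, z + w, hz.add hw, by rw [map_add, mul_add, mul_add, hxz, hyw]⟩
  | zero => exact ⟨Blk.zero _ _, 0, IsCent.zero, by rw [map_zero]⟩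
  | mul x y _ _ hx hy => exact ⟨hx.1.mul hy.1, h.exists_cent_mul hx.1 hy.1 hx.2 hy.2⟩
  | smul r x _ hx =>
    obtain ⟨hx, z, hz, hxz⟩ := hx
    exact ⟨hx.smul r, r • z, hz.smul r, by rw [map_smul, mul_smul_comm, mul_smul_comm, hxz]⟩

lemma comm_of_comm (h : LieSplit e f φ) {a b : A} (ha : Blk e e a) (hb : Blk f f b)
    (hab : a * φ b = φ b * a) : φ a * b = b * φ a := by
  have hc := h.cent_diag a b ha hb
  rw [hab, sub_self, add_zero] at hc
  refine sub_eq_zero.1 (h.q.symm.eq_zero_of_isCent hc ?_)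
  rw [mul_sub, ← mul_assoc, h.map_diag a (h.q.comm_of_ee ha), mul_assoc, ← mul_assoc e b,
    ← hb.1, ← mul_assoc e f, h.q.ef, zero_mul, mul_zero, zero_mul, sub_self]

lemma comm_of_exists_cent (h : LieSplit e f φ) {a b : A} (ha : Blk e e a) (hb : Blk f f b)
    (hz : ∃ z, IsCent z ∧ f * z = f * φ a) : φ a * b = b * φ a := by
  obtain ⟨z, hz, hfz⟩ := hz
  have hfa := h.q.comm_f (h.map_diag a (h.q.comm_of_ee ha))
  rw [← hb.1, ← mul_assoc, ← hfa, ← hfz, ← hz, mul_assoc, hb.1, hz b, ← hb.2, mul_assoc b f, hfz,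
    mul_assoc]

lemma exists_cent_of_comm (h : LieSplit e f φ)
    (hcen : cornerCenter e = (fun z : A => e * z * e) '' centerSet A) {b : A} (hb : Blk f f b)
    (hab : ∀ a, Blk e e a → a * φ b = φ b * a) : ∃ z, IsCent z ∧ e * z = e * φ b := by
  have hd := h.map_diag b (h.q.comm_of_ff hb)
  have hbb := h.q.blk_mul hd
  have hmem : e * φ b ∈ cornerCenter e := by
    refine ⟨by rw [hbb.1, hbb.2], fun a => ?_⟩
    have ha := h.q.blk_ee a
    rw [hd, mul_assoc, ha.1, ← hab _ ha, ← hd, ← mul_assoc, ha.2]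
  rw [hcen] at hmem
  obtain ⟨z, hz, hze⟩ := hmem
  have hz' : IsCent z := hz
  refine ⟨z, hz', ?_⟩
  rw [← hze]
  change e * z = e * z * e
  rw [mul_assoc, hz', ← mul_assoc, h.q.ee]

lemma comm_of_condStar (h : LieSplit e f φ) (hs : CornerCondStar e) {a b : A}
    (ha : Blk e e a) (hb : Blk f f b) : a * φ b = φ b * a := by
  have hd := h.map_diag b (h.q.comm_of_ff hb)
  have hbb := h.q.blk_mul hd
  have hmem : e * φ b ∈ cornerCenter e := by
    refine hs _ (by rw [hbb.1, hbb.2]) fun u => ?_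
    have hu := h.q.blk_ee u
    have hdu := h.map_diag _ (h.q.comm_of_ee hu)
    have hc := (h.cent_diag _ _ hu hb).neg
    have hblk : Blk e e (e * φ b * (e * u * e) - e * u * e * (e * φ b)) :=
      (hbb.mul hu).sub (hu.mul hbb)
    have heq : e * φ b * (e * u * e) - e * u * e * (e * φ b) =
        e * -(φ (e * u * e) * b - b * φ (e * u * e) +
          (e * u * e * φ b - φ b * (e * u * e))) := by
      have h1 : e * (φ (e * u * e) * b) = 0 := by
        rw [← mul_assoc, hdu, mul_assoc, ← hb.1, ← mul_assoc e f, h.q.ef, zero_mul, mul_zero]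
      have h2 : e * (b * φ (e * u * e)) = 0 := by
        rw [← mul_assoc, ← hb.1, ← mul_assoc e f, h.q.ef, zero_mul, zero_mul]
      generalize φ (e * u * e) = v at *
      generalize e * u * e = w at *
      have h3 : w * (e * φ b) = e * (w * φ b) := by
        rw [← mul_assoc, hu.2, ← mul_assoc, hu.1]
      rw [h3]
      simp only [mul_neg, mul_add, mul_sub, h1, h2, mul_assoc]
      abel
    refine ⟨by rw [hblk.1, hblk.2], fun v => ?_⟩
    have hv := h.q.blk_ee v
    rw [heq, ← mul_assoc (e * v * e), hv.2, ← hc (e * v * e), ← hc e, mul_assoc, hv.1]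
  have := hmem.2 a
  rw [ha.1, ha.2, hd, mul_assoc, ha.1, ← hd, ← mul_assoc, ha.2] at this
  exact this.symm

lemma exists_cent_both (h : LieSplit e f φ)
    (hyp : (CornerGenerated R e ∧ CornerGenerated R f) ∨
      (CornerGenerated R e ∧ cornerCenter e = (fun z : A => e * z * e) '' centerSet A) ∨
      (CornerGenerated R f ∧ cornerCenter f = (fun z : A => f * z * f) '' centerSet A) ∨
      (cornerCenter e = (fun z : A => e * z * e) '' centerSet A ∧
        cornerCenter f = (fun z : A => f * z * f) '' centerSet A ∧
        ((∀ a b, Blk e e a → Blk f f b → φ a * b - b * φ a + (a * φ b - φ b * a) = 0) ∨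
          CornerCondStar e ∨ CornerCondStar f))) :
    (∀ a, Blk e e a → ∃ z, IsCent z ∧ f * z = f * φ a) ∧
      ∀ b, Blk f f b → ∃ z, IsCent z ∧ e * z = e * φ b := by
  rcases hyp with ⟨h1, h2⟩ | ⟨h1, h2⟩ | ⟨h1, h2⟩ | ⟨h1, h2, h3⟩
  · exact ⟨fun a => h.exists_cent_of_cornerGenerated h1,
      fun b => h.symm.exists_cent_of_cornerGenerated h2⟩
  · have h3 := fun a (ha : Blk e e a) => h.exists_cent_of_cornerGenerated h1 ha
    exact ⟨h3, fun b hb => h.exists_cent_of_comm h2 hb fun a ha =>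
      (h.symm.comm_of_comm hb ha (h.comm_of_exists_cent ha hb (h3 a ha)).symm).symm⟩
  · have h3 := fun a (ha : Blk f f a) => h.symm.exists_cent_of_cornerGenerated h1 ha
    exact ⟨fun b hb => h.symm.exists_cent_of_comm h2 hb fun a ha =>
      (h.comm_of_comm hb ha (h.symm.comm_of_exists_cent ha hb (h3 a ha)).symm).symm, h3⟩
  · have key : ∀ a b, Blk e e a → Blk f f b → φ a * b = b * φ a ∧ a * φ b = φ b * a := by
      intro a b ha hb
      rcases h3 with h3 | h3 | h3
      · have h4 := h3 a b ha hb
        have h5 : e * (φ a * b) = 0 := by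
          rw [← mul_assoc, h.map_diag a (h.q.comm_of_ee ha), mul_assoc, ← hb.1, ← mul_assoc e f,
            h.q.ef, zero_mul, mul_zero]
        have h6 : e * (b * φ a) = 0 := by
          rw [← mul_assoc, ← hb.1, ← mul_assoc e f, h.q.ef, zero_mul, zero_mul]
        have h7 : a * φ b = φ b * a := by
          have := congrArg (e * ·) h4
          simp only [mul_add, mul_sub, h5, h6, ← mul_assoc, ha.1, mul_zero,
            h.map_diag b (h.q.comm_of_ff hb)] at this
          rw [mul_assoc (φ b), ha.1, sub_self, zero_add] at this
          exact sub_eq_zero.1 this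
        exact ⟨h.comm_of_comm ha hb h7, h7⟩
      · have h7 := h.comm_of_condStar h3 ha hb
        exact ⟨h.comm_of_comm ha hb h7, h7⟩
      · have h7 := h.symm.comm_of_condStar h3 hb ha
        exact ⟨h7.symm, (h.symm.comm_of_comm hb ha h7).symm⟩
    exact ⟨fun a ha => h.symm.exists_cent_of_comm h2 ha fun b hb => (key a b ha hb).1.symm,
      fun b hb => h.exists_cent_of_comm h1 hb fun a ha => (key a b ha hb).2⟩

lemma exists_central_map (h : LieSplit e f φ)
    (hz : ∀ a, Blk e e a → ∃ z, IsCent z ∧ f * z = f * φ a) :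
    ∃ γ : A →ₗ[R] A, (∀ x, IsCent (γ x)) ∧ ∀ x, f * γ x = f * φ (e * x * e) := by
  choose g hg hfg using fun x => hz _ (h.q.blk_ee x)
  refine ⟨{ toFun := g, map_add' := fun x y => ?_, map_smul' := fun r x => ?_ }, hg, hfg⟩
  · refine sub_eq_zero.1 (h.q.eq_zero_of_isCent ((hg _).sub ((hg x).add (hg y))) ?_)
    rw [mul_sub, mul_add, hfg, hfg, hfg, mul_add, add_mul, map_add, mul_add, sub_self]
  · refine sub_eq_zero.1 (h.q.eq_zero_of_isCent ((hg _).sub ((hg x).smul r)) ?_)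
    rw [RingHom.id_apply, mul_sub, mul_smul_comm, hfg, hfg, mul_smul_comm, smul_mul_assoc,
      map_smul, mul_smul_comm, sub_self]

end LieSplit

/-- An `R`-linear map respecting the Peirce decomposition which satisfies the Leibniz rule for
products of a diagonal with an off-diagonal element, and almost so for two off-diagonal ones. -/
structure DerSplit (e f : A) (d : A →ₗ[R] A) : Prop where
  q : PeirceQ e f
  map_ee : ∀ a, Blk e e a → Blk e e (d a)
  map_ef : ∀ m, Blk e f m → Blk e f (d m)
  map_fe : ∀ t, Blk f e t → Blk f e (d t)
  map_ff : ∀ b, Blk f f b → Blk f f (d b)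
  mul_ee_ef : ∀ a m, Blk e e a → Blk e f m → d (a * m) = d a * m + a * d m
  mul_ef_ff : ∀ m b, Blk e f m → Blk f f b → d (m * b) = d m * b + m * d b
  mul_fe_ee : ∀ t a, Blk f e t → Blk e e a → d (t * a) = d t * a + t * d a
  mul_ff_fe : ∀ b t, Blk f f b → Blk f e t → d (b * t) = d b * t + b * d t
  cent : ∀ m t, Blk e f m → Blk f e t →
    IsCent ((d (m * t) - d m * t - m * d t) - (d (t * m) - d t * m - t * d m))

lemma LieSplit.exists_derSplit {e f : A} {φ : A →ₗ[R] A} (h : LieSplit e f φ)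
    (hz : ∀ a, Blk e e a → ∃ z, IsCent z ∧ f * z = f * φ a)
    (hw : ∀ b, Blk f f b → ∃ z, IsCent z ∧ e * z = e * φ b) :
    ∃ d γ : A →ₗ[R] A, DerSplit e f d ∧ (∀ x, IsCent (γ x)) ∧ φ = d + γ := by
  obtain ⟨γ, hγ, hfγ⟩ := h.exists_central_map hz
  obtain ⟨δ, hδ, heδ⟩ := h.symm.exists_central_map hw
  have γ_zero : ∀ x, e * x * e = 0 → γ x = 0 := fun x hx =>
    h.q.eq_zero_of_isCent (hγ x) (by rw [hfγ, hx, map_zero, mul_zero])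
  have δ_zero : ∀ x, f * x * f = 0 → δ x = 0 := fun x hx =>
    h.q.symm.eq_zero_of_isCent (hδ x) (by rw [heδ, hx, map_zero, mul_zero])
  have γ_ef : ∀ x, Blk e f x → γ x = 0 := fun x hx => γ_zero x (by
    rw [hx.1, ← hx.2, mul_assoc, h.q.fe, mul_zero])
  have γ_fe : ∀ x, Blk f e x → γ x = 0 := fun x hx => γ_zero x (by
    rw [mul_assoc, hx.2, ← hx.1, ← mul_assoc, h.q.ef, zero_mul])
  have γ_ff : ∀ x, Blk f f x → γ x = 0 := fun x hx => γ_zero x (by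
    rw [mul_assoc, ← hx.1, mul_assoc, ← mul_assoc, h.q.ef, zero_mul])
  have δ_ef : ∀ x, Blk e f x → δ x = 0 := fun x hx => δ_zero x (by
    rw [mul_assoc, hx.2, ← hx.1, ← mul_assoc, h.q.fe, zero_mul])
  have δ_fe : ∀ x, Blk f e x → δ x = 0 := fun x hx => δ_zero x (by
    rw [hx.1, ← hx.2, mul_assoc, h.q.ef, mul_zero])
  have δ_ee : ∀ x, Blk e e x → δ x = 0 := fun x hx => δ_zero x (by
    rw [mul_assoc, ← hx.1, mul_assoc, ← mul_assoc, h.q.fe, zero_mul])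
  have hd : ∀ x, (φ - γ - δ) x = φ x - γ x - δ x := fun x => rfl
  have ee : ∀ x, Blk e e x → (φ - γ - δ) x = φ x - γ x := fun x hx => by
    rw [hd, δ_ee x hx, sub_zero]
  have ff : ∀ x, Blk f f x → (φ - γ - δ) x = φ x - δ x := fun x hx => by
    rw [hd, γ_ff x hx, sub_zero]
  have ef : ∀ x, Blk e f x → (φ - γ - δ) x = φ x := fun x hx => by
    rw [hd, γ_ef x hx, δ_ef x hx, sub_zero, sub_zero]
  have fe : ∀ x, Blk f e x → (φ - γ - δ) x = φ x := fun x hx => by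
    rw [hd, γ_fe x hx, δ_fe x hx, sub_zero, sub_zero]
  have mee : ∀ a, Blk e e a → Blk e e ((φ - γ - δ) a) := by
    intro a ha
    have h1 : f * (φ a - γ a) = 0 := by rw [mul_sub, hfγ, ha.1, ha.2, sub_self]
    have h2 : e * (φ a - γ a) = φ a - γ a := by
      conv_rhs => rw [h.q.diag_decomp (φ a - γ a), h1, add_zero]
    rw [ee a ha]
    refine ⟨h2, ?_⟩
    rw [sub_mul, ← h.map_diag a (h.q.comm_of_ee ha), hγ, ← mul_sub, h2]
  have mff : ∀ a, Blk f f a → Blk f f ((φ - γ - δ) a) := by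
    intro a ha
    have h1 : e * (φ a - δ a) = 0 := by rw [mul_sub, heδ, ha.1, ha.2, sub_self]
    have h2 : f * (φ a - δ a) = φ a - δ a := by
      conv_rhs => rw [h.q.diag_decomp (φ a - δ a), h1, zero_add]
    rw [ff a ha]
    refine ⟨h2, ?_⟩
    rw [sub_mul, ← h.q.comm_f (h.map_diag a (h.q.comm_of_ff ha)), hδ, ← mul_sub, h2]
  refine ⟨φ - γ - δ, γ + δ, ⟨h.q, mee, ?_, ?_, mff, ?_, ?_, ?_, ?_, ?_⟩,
    fun x => (hγ x).add (hδ x), by abel⟩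
  · intro m hm; rw [ef m hm]; exact h.map_ef m hm
  · intro m hm; rw [fe m hm]; exact h.map_fe m hm
  · intro a m ha hm
    rw [ef m hm, ef _ (ha.mul hm), h.map_mul_ef ha hm]
    have h1 := hm.mul_eq_zero (mee a ha) h.q.fe
    rw [ee a ha] at h1 ⊢
    linear_combination (norm := noncomm_ring) hγ a m - h1
  · intro m b hm hb
    rw [ef m hm, ef _ (hm.mul hb), h.symm.map_mul_fe hb hm]
    have h1 := (mff b hb).mul_eq_zero hm h.q.fe
    rw [ff b hb] at h1 ⊢
    linear_combination (norm := noncomm_ring) -hδ b m - h1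
  · intro t a ht ha
    rw [fe t ht, fe _ (ht.mul ha), h.map_mul_fe ha ht]
    have h1 := (mee a ha).mul_eq_zero ht h.q.ef
    rw [ee a ha] at h1 ⊢
    linear_combination (norm := noncomm_ring) -hγ a t - h1
  · intro b t hb ht
    rw [fe t ht, fe _ (hb.mul ht), h.symm.map_mul_ef hb ht]
    have h1 := ht.mul_eq_zero (mff b hb) h.q.ef
    rw [ff b hb] at h1 ⊢
    linear_combination (norm := noncomm_ring) hδ b t - h1
  · intro m t hm ht
    rw [ef m hm, fe t ht, ee _ (hm.mul ht), ff _ (ht.mul hm)]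
    have h1 := ((h.cent_off m t hm ht).sub (hγ (m * t))).add (hδ (t * m))
    rw [map_sub] at h1
    convert h1 using 1
    abel

namespace DerSplit

variable {e f : A} {d : A →ₗ[R] A}

lemma symm (h : DerSplit e f d) : DerSplit f e d where
  q := h.q.symm
  map_ee := h.map_ff
  map_ef := h.map_fe
  map_fe := h.map_ef
  map_ff := h.map_ee
  mul_ee_ef := h.mul_ff_fe
  mul_ef_ff := h.mul_fe_ee
  mul_fe_ee := h.mul_ef_ff
  mul_ff_fe := h.mul_ee_ef
  cent m t hm ht := by
    have := (h.cent t m ht hm).neg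
    rwa [neg_sub] at this

lemma mul_ee_ee (h : DerSplit e f d) {a b : A} (ha : Blk e e a) (hb : Blk e e b) :
    d (a * b) = d a * b + a * d b := by
  refine sub_eq_zero.1 (h.q.qe _ ((h.map_ee _ (ha.mul hb)).sub
    (((h.map_ee a ha).mul hb).add (ha.mul (h.map_ee b hb)))) (fun m hm => ?_) fun t ht => ?_)
  · have h1 := h.mul_ee_ef _ m (ha.mul hb) hm
    rw [mul_assoc a b m, h.mul_ee_ef a _ ha (hb.mul hm), h.mul_ee_ef b m hb hm] at h1
    linear_combination (norm := noncomm_ring) -h1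
  · have h1 := h.mul_fe_ee t _ ht (ha.mul hb)
    rw [← mul_assoc t a b, h.mul_fe_ee _ b (ht.mul ha) hb, h.mul_fe_ee t a ht ha] at h1
    linear_combination (norm := noncomm_ring) -h1

/-- The failure of the Leibniz rule on the product `m * t`. -/
def defect (d : A →ₗ[R] A) (m t : A) : A := d (m * t) - d m * t - m * d t

lemma defect_blk (h : DerSplit e f d) {m t : A} (hm : Blk e f m) (ht : Blk f e t) :
    Blk e e (defect d m t) :=
  ((h.map_ee _ (hm.mul ht)).sub ((h.map_ef m hm).mul ht)).sub (hm.mul (h.map_fe t ht))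

lemma defect_mul_left (h : DerSplit e f d) {a m t : A} (ha : Blk e e a) (hm : Blk e f m)
    (ht : Blk f e t) : defect d (a * m) t = a * defect d m t := by
  simp only [defect]
  rw [mul_assoc a m t, h.mul_ee_ee ha (hm.mul ht), h.mul_ee_ef a m ha hm]
  noncomm_ring

lemma defect_mul (h : DerSplit e f d) {m t m' : A} (hm : Blk e f m) (ht : Blk f e t)
    (hm' : Blk e f m') : defect d m t * m' = m * defect d t m' := by
  have h1 := h.mul_ee_ef _ m' (hm.mul ht) hm'
  rw [mul_assoc m t m', h.mul_ef_ff m _ hm (ht.mul hm')] at h1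
  simp only [defect]
  linear_combination (norm := noncomm_ring) -h1

lemma isCent_defect_sub (h : DerSplit e f d) {m t : A} (hm : Blk e f m) (ht : Blk f e t) :
    IsCent (defect d m t - defect d t m) := h.cent m t hm ht

lemma defect_comm (h : DerSplit e f d) {m t x : A} (hm : Blk e f m) (ht : Blk f e t)
    (hx : Blk e e x) : x * defect d m t = defect d m t * x := by
  have h1 := h.isCent_defect_sub hm ht x
  rw [sub_mul, mul_sub, (h.symm.defect_blk ht hm).mul_eq_zero hx h.q.fe,
    hx.mul_eq_zero (h.symm.defect_blk ht hm) h.q.ef, sub_zero, sub_zero] at h1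
  exact h1.symm

lemma defect_mul' (h : DerSplit e f d) {m t m' : A} (hm : Blk e f m) (ht : Blk f e t)
    (hm' : Blk e f m') : defect d m t * m' = -(m' * defect d t m) := by
  have h1 := h.isCent_defect_sub hm ht m'
  rw [sub_mul, mul_sub, (h.symm.defect_blk ht hm).mul_eq_zero hm' h.q.fe,
    hm'.mul_eq_zero (h.defect_blk hm ht) h.q.fe, sub_zero, zero_sub] at h1
  exact h1

lemma defect_mul_swap (h : DerSplit e f d) {m t m' : A} (hm : Blk e f m) (ht : Blk f e t)
    (hm' : Blk e f m') : defect d m t * m' = -(defect d m' t * m) := by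
  rw [h.defect_mul hm ht hm', h.defect_mul' hm' ht hm, neg_neg]

lemma defect_eq_zero_symm (h : DerSplit e f d)
    (h0 : ∀ m t, Blk e f m → Blk f e t → defect d m t = 0) (t m : A) (ht : Blk f e t)
    (hm : Blk e f m) : defect d t m = 0 := by
  have h1 := h.isCent_defect_sub hm ht
  rw [h0 m t hm ht] at h1
  have h2 := h.q.symm.eq_zero_of_isCent h1 (by
    rw [zero_sub, mul_neg, ← (h.symm.defect_blk ht hm).1, ← mul_assoc, h.q.ef, zero_mul,
      neg_zero])
  rwa [zero_sub, neg_eq_zero] at h2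

lemma defect_eq_zero_of_noNonzeroCentralIdeal (h : DerSplit e f d)
    (hI : NoNonzeroCentralIdeal R A e) (m t : A) (hm : Blk e f m) (ht : Blk f e t) :
    defect d m t = 0 := by
  set S : Set A := {x | ∃ m t, Blk e f m ∧ Blk f e t ∧ x = defect d m t} with hS
  have hblk : ∀ x ∈ Submodule.span R S, Blk e e x := by
    intro x hx
    induction hx using Submodule.span_induction with
    | mem x hx => obtain ⟨m, t, hm, ht, rfl⟩ := hx; exact h.defect_blk hm ht
    | zero => exact Blk.zero _ _
    | add x y _ _ hx hy => exact hx.add hy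
    | smul r x _ hx => exact hx.smul r
  have hcomm : ∀ a, Blk e e a → ∀ x ∈ Submodule.span R S, a * x = x * a := by
    intro a ha x hx
    induction hx using Submodule.span_induction with
    | mem x hx => obtain ⟨m, t, hm, ht, rfl⟩ := hx; exact h.defect_comm hm ht ha
    | zero => rw [mul_zero, zero_mul]
    | add x y _ _ hx hy => rw [mul_add, add_mul, hx, hy]
    | smul r x _ hx => rw [mul_smul_comm, smul_mul_assoc, hx]
  have hleft : ∀ a, Blk e e a → ∀ x ∈ Submodule.span R S, a * x ∈ Submodule.span R S := by
    intro a ha x hx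
    induction hx using Submodule.span_induction with
    | mem x hx =>
      obtain ⟨m, t, hm, ht, rfl⟩ := hx
      exact Submodule.subset_span ⟨a * m, t, ha.mul hm, ht, (h.defect_mul_left ha hm ht).symm⟩
    | zero => rw [mul_zero]; exact Submodule.zero_mem _
    | add x y _ _ hx hy => rw [mul_add]; exact Submodule.add_mem _ hx hy
    | smul r x _ hx => rw [mul_smul_comm]; exact Submodule.smul_mem _ _ hx
  refine hI (Submodule.span R S : Set A) (Submodule.zero_mem _) (fun x hx => ?_)
    (fun x hx y hy => Submodule.add_mem _ hx hy) (fun r x hx => Submodule.smul_mem _ r hx)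
    (fun x hx a => hleft _ (h.q.blk_ee a) x hx) (fun x hx a => ?_)
    (fun x hx a => (hcomm _ (h.q.blk_ee a) x hx).symm) _
    (Submodule.subset_span ⟨m, t, hm, ht, rfl⟩)
  · rw [(hblk x hx).1, (hblk x hx).2]
  · rw [← hcomm _ (h.q.blk_ee a) x hx]
    exact hleft _ (h.q.blk_ee a) x hx

lemma defect_mul_self (h : DerSplit e f d) (h2 : TorsionFreeAt A 2) {m t : A}
    (hm : Blk e f m) (ht : Blk f e t) : defect d m t * m = 0 := by
  refine h2 _ ?_
  rw [two_nsmul]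
  nth_rewrite 1 [h.defect_mul_swap hm ht hm]
  rw [neg_add_cancel]

lemma defect_eq_zero_of_separating (h : DerSplit e f d) (h2 : TorsionFreeAt A 2) {m₀ : A}
    (hm₀ : Blk e f m₀)
    (hK : ∀ z, IsCent z → e * z * e * m₀ = 0 → IsCent (e * z * e)) (m t : A)
    (hm : Blk e f m) (ht : Blk f e t) : defect d m t = 0 := by
  have key : ∀ m t, Blk e f m → Blk f e t → defect d m t * m₀ = 0 → defect d m t = 0 := by
    intro m t hm ht h0
    have hb := h.defect_blk hm ht
    have hz : e * (defect d m t - defect d t m) * e = defect d m t := by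
      have hb' := h.symm.defect_blk ht hm
      rw [mul_sub, sub_mul, hb.1, hb.2, ← hb'.1, ← mul_assoc, h.q.ef, zero_mul, zero_mul,
        sub_zero]
    have hc := hK _ (h.isCent_defect_sub hm ht) (by rw [hz, h0])
    rw [hz] at hc
    exact h.q.eq_zero_of_isCent hc (by rw [← hb.1, ← mul_assoc, h.q.fe, zero_mul])
  refine key m t hm ht ?_
  rw [h.defect_mul_swap hm ht hm₀, key m₀ t hm₀ ht (h.defect_mul_self h2 hm₀ ht), zero_mul,
    neg_zero]

lemma isDeriv (h : DerSplit e f d)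
    (h1 : ∀ m t, Blk e f m → Blk f e t → defect d m t = 0)
    (h2 : ∀ t m, Blk f e t → Blk e f m → defect d t m = 0) : IsDeriv d := by
  have hz : ∀ {x y g k l i : A}, k * l = 0 → Blk g k x → Blk l i y → Blk g k (d x) →
      Blk l i (d y) → d (x * y) = d x * y + x * d y := by
    intro x y g k l i h0 hx hy hdx hdy
    rw [hx.mul_eq_zero hy h0, hdx.mul_eq_zero hy h0, hx.mul_eq_zero hdy h0, map_zero, add_zero]
  have hadd : ∀ x u v, d (x * u) = d x * u + x * d u → d (x * v) = d x * v + x * d v →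
      d (x * (u + v)) = d x * (u + v) + x * d (u + v) := by
    intro x u v hu hv
    rw [mul_add, map_add, hu, hv, map_add]
    noncomm_ring
  intro x y
  revert x
  refine h.q.induction ?_ ?_ ?_ ?_ ?_
  · intro u v hu hv
    rw [add_mul, map_add, hu, hv, map_add]
    noncomm_ring
  · intro x hx
    revert y
    refine h.q.induction (hadd x) ?_ ?_ ?_ ?_ <;> intro y hy
    · exact h.mul_ee_ee hx hy
    · exact h.mul_ee_ef x y hx hy
    · exact hz h.q.ef hx hy (h.map_ee x hx) (h.map_fe y hy)
    · exact hz h.q.ef hx hy (h.map_ee x hx) (h.map_ff y hy)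
  · intro x hx
    revert y
    refine h.q.induction (hadd x) ?_ ?_ ?_ ?_ <;> intro y hy
    · exact hz h.q.fe hx hy (h.map_ef x hx) (h.map_ee y hy)
    · exact hz h.q.fe hx hy (h.map_ef x hx) (h.map_ef y hy)
    · have := h1 x y hx hy
      rwa [defect, sub_sub, sub_eq_zero] at this
    · exact h.mul_ef_ff x y hx hy
  · intro x hx
    revert y
    refine h.q.induction (hadd x) ?_ ?_ ?_ ?_ <;> intro y hy
    · exact h.mul_fe_ee x y hx hy
    · have := h2 x y hx hy
      rwa [defect, sub_sub, sub_eq_zero] at this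
    · exact hz h.q.ef hx hy (h.map_fe x hx) (h.map_fe y hy)
    · exact hz h.q.ef hx hy (h.map_fe x hx) (h.map_ff y hy)
  · intro x hx
    revert y
    refine h.q.induction (hadd x) ?_ ?_ ?_ ?_ <;> intro y hy
    · exact hz h.q.fe hx hy (h.map_ff x hx) (h.map_ee y hy)
    · exact hz h.q.fe hx hy (h.map_ff x hx) (h.map_ef y hy)
    · exact h.mul_ff_fe x y hx hy
    · exact h.symm.mul_ee_ee hx hy

lemma isDeriv_of_cond (h : DerSplit e f d) (h2 : TorsionFreeAt A 2)
    (hyp : (NoNonzeroCentralIdeal R A e ∨ NoNonzeroCentralIdeal R A f) ∨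
      (∃ m₀ : A, m₀ = e * m₀ * f ∧
        centerSet A = {x : A | ∃ a b : A,
          (∃ z : A, IsCent z ∧ a = e * z * e) ∧
          (∃ z : A, IsCent z ∧ b = f * z * f) ∧
          a * m₀ = m₀ * b ∧ x = a + b}) ∨
      (∃ t₀ : A, t₀ = f * t₀ * e ∧
        centerSet A = {x : A | ∃ a b : A,
          (∃ z : A, IsCent z ∧ a = e * z * e) ∧
          (∃ z : A, IsCent z ∧ b = f * z * f) ∧
          t₀ * a = b * t₀ ∧ x = a + b}) ∨
      (∀ m t : A, (e * m * f) * (f * t * e) = 0 ∧ (f * t * e) * (e * m * f) = 0)) :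
    IsDeriv d := by
  have left : (∀ m t, Blk e f m → Blk f e t → defect d m t = 0) → IsDeriv d :=
    fun h0 => h.isDeriv h0 (h.defect_eq_zero_symm h0)
  have right : (∀ t m, Blk f e t → Blk e f m → defect d t m = 0) → IsDeriv d :=
    fun h0 => h.isDeriv (h.symm.defect_eq_zero_symm h0) h0
  rcases hyp with (hI | hI) | ⟨m₀, hm₀, hZ⟩ | ⟨t₀, ht₀, hZ⟩ | h0
  · exact left (h.defect_eq_zero_of_noNonzeroCentralIdeal hI)
  · exact right (h.symm.defect_eq_zero_of_noNonzeroCentralIdeal hI)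
  · refine left (h.defect_eq_zero_of_separating h2 (m₀ := m₀) ?_ fun z hz h0 => ?_)
    · rw [hm₀]; exact h.q.blk_ef m₀
    · change e * z * e ∈ centerSet A
      rw [hZ]
      exact ⟨_, 0, ⟨z, hz, rfl⟩, ⟨0, IsCent.zero, by simp⟩, by rw [h0, mul_zero],
        (add_zero _).symm⟩
  · refine right (h.symm.defect_eq_zero_of_separating h2 (m₀ := t₀) ?_ fun z hz h0 => ?_)
    · rw [ht₀]; exact h.q.symm.blk_ef t₀
    · change f * z * f ∈ centerSet A
      rw [hZ]
      exact ⟨0, _, ⟨0, IsCent.zero, by simp⟩, ⟨z, hz, rfl⟩, by rw [h0, mul_zero],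
        (zero_add _).symm⟩
  · have h1 : ∀ m t, Blk e f m → Blk f e t → m * t = 0 := by
      intro m t hm ht
      have := (h0 m t).1
      rwa [hm.1, hm.2, ht.1, ht.2] at this
    refine left fun m t hm ht => ?_
    rw [defect, h1 m t hm ht, h1 _ t (h.map_ef m hm) ht, h1 m _ hm (h.map_fe t ht), map_zero,
      sub_zero, sub_zero]

end DerSplit

lemma PeirceQ.blk_of_adR_neg {e f : A} (h : PeirceQ e f) (h2 : TorsionFreeAt A 2) {y : A}
    (hy : adR e y = -y) : Blk e f y := by
  rw [adR] at hy
  have h1 : e * y * e = 0 := by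
    have := congrArg (fun u => e * u * e) hy
    simp only [mul_sub, sub_mul, mul_neg, neg_mul, mul_assoc, h.ee] at this
    rw [← mul_assoc e e, h.ee, sub_self, zero_eq_neg] at this
    rw [mul_assoc, this]
  have h3 : f * y * f = 0 := by
    have := congrArg (fun u => f * u * f) hy
    simp only [mul_sub, sub_mul, mul_neg, neg_mul, mul_assoc, h.ef, mul_zero] at this
    rw [← mul_assoc f e, h.fe, zero_mul, sub_zero, zero_eq_neg] at this
    rw [mul_assoc, this]
  have h4 : f * y * e = 0 := by
    have := congrArg (fun u => f * u * e) hy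
    simp only [mul_sub, sub_mul, mul_neg, neg_mul, mul_assoc, h.ee] at this
    rw [← mul_assoc f e, h.fe, zero_mul, sub_zero] at this
    refine h2 _ ?_
    rw [two_nsmul, mul_assoc]
    nth_rewrite 1 [this]
    rw [neg_add_cancel]
  rw [h.decomp y, h1, h3, h4, zero_add, add_zero, add_zero]
  exact h.blk_ef y

lemma PeirceQ.adR_symm {e f : A} (h : PeirceQ e f) (y : A) : adR f y = -adR e y := by
  rw [show f = 1 - e from eq_sub_of_add_eq' h.one]
  simp only [adR]
  noncomm_ring

lemma Blk.adR_ef {e f m : A} (h : PeirceQ e f) (hm : Blk e f m) : adR e m = -m := by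
  rw [adR, hm.1, ← hm.2, mul_assoc, h.fe, mul_zero, zero_sub]

lemma Blk.adR_fe {e f t : A} (h : PeirceQ e f) (ht : Blk f e t) : adR e t = t := by
  rw [adR, ht.2, ← ht.1, ← mul_assoc, h.ef, zero_mul, sub_zero]

lemma Blk.commutator {g h x m : A} (hg : g * x = x * g) (hh : h * x = x * h)
    (hm : Blk g h m) : Blk g h (x * m - m * x) := by
  refine ⟨?_, ?_⟩
  · rw [mul_sub, ← mul_assoc, hg, mul_assoc, hm.1, ← mul_assoc, hm.1]
  · rw [sub_mul, mul_assoc, hm.2, mul_assoc, ← hh, ← mul_assoc, hm.2]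

lemma comm_commutator {e x y : A} (hx : e * x = x * e) (hy : e * y = y * e) :
    e * (x * y - y * x) = (x * y - y * x) * e := by
  rw [mul_sub, sub_mul, ← mul_assoc, hx, mul_assoc, hy, ← mul_assoc, ← mul_assoc e y, hy,
    mul_assoc y e, hx, ← mul_assoc]

lemma comm_commutator_off {e f m t : A} (h : PeirceQ e f) (hm : Blk e f m) (ht : Blk f e t) :
    e * (m * t - t * m) = (m * t - t * m) * e := by
  rw [mul_sub, sub_mul, h.comm_of_ee (hm.mul ht), h.comm_of_ff (ht.mul hm)]

lemma IsLieNDeriv.lieSplit {e f : A} {φ : A →ₗ[R] A} {j : ℕ}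
    (hφ : IsLieNDeriv (2 * j + 2) φ) (q : PeirceQ e f) (h2 : TorsionFreeAt A 2)
    (he : IsCent (φ e)) : LieSplit e f φ := by
  have one : ∀ x, φ (adR e x) = adR e (φ x) := by
    intro x
    have := hφ.tail_one he x
    rwa [adR_iterate_odd q.ee, adR_iterate_odd q.ee] at this
  have mef : ∀ m, Blk e f m → Blk e f (φ m) := by
    intro m hm
    refine q.blk_of_adR_neg h2 ?_
    rw [← one, hm.adR_ef q, map_neg]
  have mfe : ∀ t, Blk f e t → Blk f e (φ t) := by
    intro t ht
    refine q.symm.blk_of_adR_neg h2 ?_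
    rw [q.adR_symm, ← one, ht.adR_fe q]
  have mdiag : ∀ x, e * x = x * e → e * φ x = φ x * e := by
    intro x hx
    have h1 := one x
    rw [adR, hx, sub_self, map_zero, adR] at h1
    exact (sub_eq_zero.1 h1.symm).symm
  have aef : ∀ m, Blk e f m → adR e (adR e m) = m := by
    intro m hm
    rw [hm.adR_ef q, hm.neg.adR_ef q, neg_neg]
  have afe : ∀ t, Blk f e t → adR e (adR e t) = t := by
    intro t ht
    rw [ht.adR_fe q, ht.adR_fe q]
  have lef : ∀ x m, e * x = x * e → Blk e f m →
      φ (x * m - m * x) = φ x * m - m * φ x + (x * φ m - φ m * x) := by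
    intro x m hx hm
    have h1 := hφ.tail_two he x m
    rwa [adR_iterate_even (aef _ (hm.commutator hx (q.comm_f hx))),
      adR_iterate_even (aef _ (hm.commutator (mdiag x hx) (q.comm_f (mdiag x hx)))),
      adR_iterate_even (aef _ ((mef m hm).commutator hx (q.comm_f hx)))] at h1
  have lfe : ∀ x t, e * x = x * e → Blk f e t →
      φ (x * t - t * x) = φ x * t - t * φ x + (x * φ t - φ t * x) := by
    intro x m hx hm
    have h1 := hφ.tail_two he x m
    rwa [adR_iterate_even (afe _ (hm.commutator (q.comm_f hx) hx)),
      adR_iterate_even (afe _ (hm.commutator (q.comm_f (mdiag x hx)) (mdiag x hx))),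
      adR_iterate_even (afe _ ((mfe m hm).commutator (q.comm_f hx) hx))] at h1
  have cent : ∀ x y, e * (x * y - y * x) = (x * y - y * x) * e →
      e * (φ x * y - y * φ x) = (φ x * y - y * φ x) * e →
      e * (x * φ y - φ y * x) = (x * φ y - φ y * x) * e →
      IsCent (φ (x * y - y * x) - (φ x * y - y * φ x + (x * φ y - φ y * x))) := by
    intro x y hu hv hw
    rcases Nat.eq_zero_or_pos j with rfl | hj
    · have h1 := hφ.tail_two he x y
      simp only [mul_zero, Function.iterate_zero, id] at h1
      rw [h1, sub_self]
      exact IsCent.zero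
    · obtain ⟨i, rfl⟩ : ∃ i, j = i + 1 := ⟨j - 1, by omega⟩
      rw [show 2 * (i + 1) + 2 = 2 * i + 1 + 3 by ring] at hφ
      have h3 := fun z => hφ.tail_three he x y z
      simp only [adR_iterate_odd q.ee] at h3
      refine q.isCent_of_comm ?_ (fun m hm => ?_) fun t ht => ?_
      · rw [mul_sub, sub_mul, mul_add, add_mul, hv, hw, mdiag _ hu]
      · have h4 := h3 m
        have h5 := lef _ m hu hm
        rw [(hm.commutator hu (q.comm_f hu)).adR_ef q,
          (hm.commutator hv (q.comm_f hv)).adR_ef q,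
          (hm.commutator hw (q.comm_f hw)).adR_ef q,
          ((mef m hm).commutator hu (q.comm_f hu)).adR_ef q, map_neg, h5] at h4
        linear_combination (norm := noncomm_ring) -h4
      · have h4 := h3 t
        have h5 := lfe _ t hu ht
        rw [(ht.commutator (q.comm_f hu) hu).adR_fe q,
          (ht.commutator (q.comm_f hv) hv).adR_fe q,
          (ht.commutator (q.comm_f hw) hw).adR_fe q,
          ((mfe t ht).commutator (q.comm_f hu) hu).adR_fe q, h5] at h4
        linear_combination (norm := noncomm_ring) h4
  refine ⟨q, mef, mfe, mdiag, lef, lfe, fun a b ha hb => ?_, fun m t hm ht => ?_⟩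
  · have da := q.comm_of_ee ha
    have db := q.comm_of_ff hb
    have h1 := (cent a b (comm_commutator da db) (comm_commutator (mdiag a da) db)
      (comm_commutator da (mdiag b db))).neg
    rwa [ha.mul_eq_zero hb q.ef, hb.mul_eq_zero ha q.fe, sub_zero, map_zero, zero_sub,
      neg_neg] at h1
  · exact cent m t (comm_commutator_off q hm ht) (comm_commutator_off q (mef m hm) ht)
      (comm_commutator_off q hm (mfe t ht))

lemma IsLieNDeriv.isCent_map_idempotent {e f : A} {φ : A →ₗ[R] A} {j : ℕ}
    (hφ : IsLieNDeriv (2 * j + 2) φ) (q : PeirceQ e f) (hj : TorsionFreeAt A (2 * j + 1))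
    (he : e * φ e = φ e * e) : IsCent (φ e) := by
  have hf := q.comm_f he
  refine q.isCent_of_comm he (fun m hm => ?_) fun t ht => ?_
  · have h1 := hφ.eigen (ε := -1) he (by rw [neg_one_smul]; exact hm.adR_ef q)
    rw [adR_iterate_odd q.ee, Odd.neg_one_pow ⟨j, rfl⟩, Even.neg_one_pow ⟨j, by ring⟩,
      one_smul, neg_one_smul, adR] at h1
    have hb := hm.commutator he hf
    have h3 := congrArg (fun u => e * u * f) h1
    have hb' : e * (m * φ e - φ e * m) * f = m * φ e - φ e * m := by
      rw [← neg_sub, mul_neg, neg_mul, hb.1, hb.2]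
    have e1 : e * (φ m * e - e * φ m) * f = -(e * φ m * f) := by
      rw [mul_sub, sub_mul, mul_assoc, mul_assoc, q.ef, ← mul_assoc e e, q.ee]
      simp
    simp only [mul_add, add_mul, mul_smul_comm, smul_mul_assoc, hb', e1, mul_neg, neg_mul] at h3
    exact (sub_eq_zero.1 (hj _ (left_eq_add.1 h3))).symm
  · have h1 := hφ.eigen (ε := 1) he (by rw [one_smul]; exact ht.adR_fe q)
    rw [adR_iterate_odd q.ee, one_pow, one_pow, one_smul, one_smul, adR] at h1
    have hb := ht.commutator hf he
    have h3 := congrArg (fun u => f * u * e) h1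
    have hb' : f * (t * φ e - φ e * t) * e = t * φ e - φ e * t := by
      rw [← neg_sub, mul_neg, neg_mul, hb.1, hb.2]
    have e1 : f * (φ t * e - e * φ t) * e = f * φ t * e := by
      rw [mul_sub, sub_mul, ← mul_assoc, mul_assoc _ e e, q.ee, ← mul_assoc f e, q.fe]
      simp
    simp only [mul_add, add_mul, mul_smul_comm, smul_mul_assoc, hb', e1] at h3
    exact (sub_eq_zero.1 (hj _ (left_eq_add.1 h3))).symm

/-- The inner derivation `x ↦ [x, u]`. -/
def innerDer (R : Type*) {A : Type*} [CommRing R] [Ring A] [Algebra R A] (u : A) : A →ₗ[R] A :=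
  LinearMap.mulRight R u - LinearMap.mulLeft R u

lemma innerDer_apply (u x : A) : innerDer R u x = x * u - u * x := rfl

lemma isDeriv_innerDer (u : A) : IsDeriv (innerDer R u) := by
  intro x y
  simp only [innerDer_apply]
  noncomm_ring

lemma PeirceQ.innerDer_comm {e f : A} (q : PeirceQ e f) (c : A) :
    e * (c - innerDer R (e * c * f - f * c * e) e) =
      (c - innerDer R (e * c * f - f * c * e) e) * e := by
  have hm := q.blk_ef c
  have ht := q.symm.blk_ef c
  have h1 : innerDer R (e * c * f - f * c * e) e = e * c * f + f * c * e := by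
    have h3 : e * (f * c * e) = 0 := by rw [← ht.1, ← mul_assoc, q.ef, zero_mul]
    have h4 : e * c * f * e = 0 := by rw [mul_assoc, q.fe, mul_zero]
    rw [innerDer_apply, mul_sub, sub_mul, hm.1, ht.2, h3, h4]
    abel
  have h5 : c - (e * c * f + f * c * e) = e * c * e + f * c * f := by
    nth_rewrite 1 [q.decomp c]
    abel
  rw [h1, h5, mul_add, add_mul, q.comm_of_ee (q.blk_ee c), q.comm_of_ff (q.symm.blk_ee c)]

lemma PropQ.peirceQ {e : A} (he : e * e = e) (hQ : PropQ e) : PeirceQ e (1 - e) := by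
  have ef : e * (1 - e) = 0 := by rw [mul_sub, he, mul_one, sub_self]
  have fe : (1 - e) * e = 0 := by rw [sub_mul, he, one_mul, sub_self]
  have ff : (1 - e) * (1 - e) = 1 - e := by rw [sub_mul, ef, sub_zero, one_mul]
  have bef : ∀ y, Blk e (1 - e) (e * y * (1 - e)) := fun y =>
    ⟨by rw [← mul_assoc, ← mul_assoc, he], by rw [mul_assoc, ff]⟩
  have bfe : ∀ y, Blk (1 - e) e ((1 - e) * y * e) := fun y =>
    ⟨by rw [← mul_assoc, ← mul_assoc, ff], by rw [mul_assoc, he]⟩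
  refine ⟨he, ff, ef, fe, by abel, fun x hx hm ht => ?_, fun x hx ht hm => ?_⟩
  · have := hQ.1 x
    rw [hx.1, hx.2] at this
    exact this ⟨fun y => hm _ (bef y), fun y => ht _ (bfe y)⟩
  · have := hQ.2 x
    rw [hx.1, hx.2] at this
    exact this ⟨fun y => hm _ (bef y), fun y => ht _ (bfe y)⟩

end PeirceDecomposition

theorem stmt_11 (R : Type*) [CommRing R] (A : Type*) [Ring A] [Algebra R A]
    (n : ℕ) (hn : 2 ≤ n) (hev : Even n)
    (h2 : TorsionFreeAt A 2) (hn1 : TorsionFreeAt A (n - 1))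
    (e : A) (he : e * e = e) (he0 : e ≠ 0) (he1 : e ≠ 1) (hQ : PropQ e)
    (hyp1 :
      (CornerGenerated R e ∧ CornerGenerated R (1 - e)) ∨
      (CornerGenerated R e ∧
        cornerCenter e = (fun z : A => e * z * e) '' centerSet A) ∨
      (CornerGenerated R (1 - e) ∧
        cornerCenter (1 - e) = (fun z : A => (1 - e) * z * (1 - e)) '' centerSet A) ∨
      (cornerCenter e = (fun z : A => e * z * e) '' centerSet A ∧
        cornerCenter (1 - e) = (fun z : A => (1 - e) * z * (1 - e)) '' centerSet A ∧
        (3 ≤ n → CornerCondStar e ∨ CornerCondStar (1 - e))))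
    (hyp2 :
      (NoNonzeroCentralIdeal R A e ∨ NoNonzeroCentralIdeal R A (1 - e)) ∨
      (∃ m₀ : A, m₀ = e * m₀ * (1 - e) ∧
        centerSet A = {x : A | ∃ a b : A,
          (∃ z : A, IsCent z ∧ a = e * z * e) ∧
          (∃ z : A, IsCent z ∧ b = (1 - e) * z * (1 - e)) ∧
          a * m₀ = m₀ * b ∧ x = a + b}) ∨
      (∃ t₀ : A, t₀ = (1 - e) * t₀ * e ∧
        centerSet A = {x : A | ∃ a b : A,
          (∃ z : A, IsCent z ∧ a = e * z * e) ∧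
          (∃ z : A, IsCent z ∧ b = (1 - e) * z * (1 - e)) ∧
          t₀ * a = b * t₀ ∧ x = a + b}) ∨
      (∀ m t : A, (e * m * (1 - e)) * ((1 - e) * t * e) = 0 ∧
        ((1 - e) * t * e) * (e * m * (1 - e)) = 0)) :
    ∀ φ : A →ₗ[R] A, IsLieNDeriv n φ → IsStandardLieNDeriv n φ := by
  intro φ hφ
  have q := hQ.peirceQ he
  obtain ⟨j, rfl⟩ : ∃ j, n = 2 * j + 2 := by
    obtain ⟨i, rfl⟩ := hev
    exact ⟨i - 1, by omega⟩
  generalize 1 - e = f at *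
  set D := innerDer R (e * φ e * f - f * φ e * e) with hD
  have hDd : IsDeriv D := isDeriv_innerDer _
  have hψ : IsLieNDeriv (2 * j + 2) (φ - D) := hφ.sub (hDd.isLieNDeriv (by omega))
  have hc : IsCent ((φ - D) e) := hψ.isCent_map_idempotent q hn1 (q.innerDer_comm _)
  have hs := hψ.lieSplit q h2 hc
  obtain ⟨hz, hw⟩ := hs.exists_cent_both (by
    refine hyp1.imp_right (Or.imp_right (Or.imp_right ?_))
    rintro ⟨h1, h3, h4⟩
    refine ⟨h1, h3, ?_⟩
    rcases Nat.eq_zero_or_pos j with rfl | hj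
    · left
      intro a b ha hb
      have h5 := hψ.tail_two (k := 0) hc a b
      simp only [Function.iterate_zero, id] at h5
      rw [← h5, ha.mul_eq_zero hb q.ef, hb.mul_eq_zero ha q.fe, sub_zero, map_zero]
    · exact Or.inr (h4 (by omega)))
  obtain ⟨d, γ, hd, hγ, heq⟩ := hs.exists_derSplit hz hw
  have hdd : IsDeriv d := hd.isDeriv_of_cond h2 hyp2
  have hφeq : φ = d + D + γ := by
    rw [add_right_comm, ← heq, sub_add_cancel]
  refine ⟨d + D, γ, hdd.add hDd, hγ, ?_, hφeq⟩
  have hγn : IsLieNDeriv (2 * j + 2) γ := by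
    rw [show γ = φ - (d + D) by rw [hφeq]; abel]
    exact hφ.sub ((hdd.add hDd).isLieNDeriv (by omega))
  intro x
  rw [hγn x]
  refine Finset.sum_eq_zero fun i hi => ?_
  have := Finset.mem_range.1 hi
  refine pCom_eq_zero_of_isCent (i := i) ?_ (by omega) (by omega)
  rw [Function.update_self]
  exact hγ _
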